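/- Except for a set of matrices A ∈ R^{m×n} (m < n) of Lebesgue measure zero, the set ginv_1(A) of ℓ^1-norm-minimizing generalized inverses of A contains exactly one matrix, and every column of this matrix has exactly m non-zero entries. -/

import Mathlib

/-- `X` is a generalized inverse of `A`, i.e. `A X A = A`. -/
def IsGenInverse {m n : ℕ} (A : Matrix (Fin m) (Fin n) ℝ) (X : Matrix (Fin n) (Fin m) ℝ) :
    Prop :=
  A * X * A = A

/-- `X` minimizes the entrywise `ℓ^1` norm among generalized inverses of `A`. -/
def MemGinv1 {m n : ℕ} (A : Matrix (Fin m) (Fin n) ℝ) (X : Matrix (Fin n) (Fin m) ℝ) :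
    Prop :=
  IsGenInverse A X ∧
    ∀ Y : Matrix (Fin n) (Fin m) ℝ, IsGenInverse A Y → ∑ i, ∑ j, |X i j| ≤ ∑ i, ∑ j, |Y i j|

open MeasureTheory Set Filter Topology Matrix

/-- The zero set of a real-analytic function on a finite-dimensional space that does not vanish
identically is a null set. -/
theorem AnalyticOnNhd.addHaar_zeros_eq_zero {E : Type*} [NormedAddCommGroup E] [NormedSpace ℝ E]
    [MeasurableSpace E] [BorelSpace E] [FiniteDimensional ℝ E] (μ : Measure E)
    [μ.IsAddHaarMeasure] {f : E → ℝ} (hf : AnalyticOnNhd ℝ f univ) {a : E} (ha : f a ≠ 0) :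
    μ {x | f x = 0} = 0 := by
  have hcont : Continuous f := continuousOn_univ.1 hf.continuousOn
  have hline (x : E) : ∀ᵐ s : ℝ, f (a + s • x) ≠ 0 := by
    have hs : AnalyticOnNhd ℝ (fun s : ℝ => f (a + s • x)) univ := fun s _ =>
      (hf _ (mem_univ _)).fun_comp (f := fun s : ℝ => a + s • x) (by fun_prop)
    have hmem := hs.preimage_zero_mem_codiscrete (x := 0) (by simpa using ha)
    have hle := ae_restrict_le_codiscreteWithin (μ := (volume : Measure ℝ)) MeasurableSet.univ
    rw [Measure.restrict_univ] at hle
    exact hle hmem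
  have hmeas : MeasurableSet {p : E × ℝ | f (a + p.2 • p.1) ≠ 0} :=
    (isOpen_ne_fun (by fun_prop) continuous_const).measurableSet
  have hslice : ∀ᵐ s : ℝ, ∀ᵐ x ∂μ, f (a + s • x) ≠ 0 :=
    (Measure.ae_ae_comm hmeas).1 (ae_of_all μ hline)
  obtain ⟨s, hs, hs0⟩ := (hslice.and (volume.ae_ne (0 : ℝ))).exists
  have hpre : μ ((s • ·) ⁻¹' {y | f (a + y) = 0}) = 0 := by
    simpa [ae_iff] using hs
  rw [Measure.addHaar_preimage_smul μ hs0, mul_eq_zero] at hpre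
  have hshift : μ {y | f (a + y) = 0} = 0 := hpre.resolve_left (by
    simpa using (by positivity : 0 < |s| ^ Module.finrank ℝ E))
  rw [← measure_preimage_add μ a]
  exact hshift

/-- A determinant whose entries are analytic functions is nonzero almost everywhere unless it
vanishes identically. -/
theorem ae_det_ne_zero {E ι : Type*} [Fintype ι] [DecidableEq ι] [NormedAddCommGroup E]
    [NormedSpace ℝ E] [MeasurableSpace E] [BorelSpace E] [FiniteDimensional ℝ E] (μ : Measure E)
    [μ.IsAddHaarMeasure] {M : E → Matrix ι ι ℝ}
    (hM : ∀ i j, AnalyticOnNhd ℝ (fun x => M x i j) univ) {a : E} (ha : (M a).det ≠ 0) :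
    ∀ᵐ x ∂μ, (M x).det ≠ 0 := by
  have hdet : AnalyticOnNhd ℝ (fun x => (M x).det) univ := by
    simp only [det_apply']
    refine Finset.analyticOnNhd_fun_sum _ fun σ _ => analyticOnNhd_const.mul ?_
    exact Finset.analyticOnNhd_fun_prod _ fun i _ => hM _ _
  simpa [ae_iff] using hdet.addHaar_zeros_eq_zero μ ha

/-- The genericity conditions: nonsingular maximal minors, no coordinate vector in the span of
fewer than `m` columns, and no nonzero kernel vector supported on `m + 1` columns orthogonal to a
vector of signs. -/
structure IsGenericMatrix {m n : ℕ} (A : Matrix (Fin m) (Fin n) ℝ) : Prop where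
  det_submatrix_ne_zero (S : Fin m ↪ Fin n) : (A.submatrix id S).det ≠ 0
  det_updateCol_ne_zero (S : Fin m ↪ Fin n) (i j : Fin m) :
    ((A.submatrix id S).updateCol i (Pi.single j 1)).det ≠ 0
  det_fromRows_ne_zero (T : Fin m ⊕ Unit ↪ Fin n) (ε : Fin m ⊕ Unit → SignType)
    (hε : ∀ k, ε k ≠ 0) : (fromRows (A.submatrix id T) (of fun (_ : Unit) k => (ε k : ℝ))).det ≠ 0

theorem analyticOnNhd_entry {m n : ℕ} (i : Fin m) (j : Fin n) :
    AnalyticOnNhd ℝ (fun A : Fin m → Fin n → ℝ => A i j) univ := fun A _ =>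
  ((ContinuousLinearMap.proj (R := ℝ) (φ := fun _ : Fin n => ℝ) j).comp
    (ContinuousLinearMap.proj (R := ℝ) (φ := fun _ : Fin m => Fin n → ℝ) i)).analyticAt A

theorem exists_submatrix_eq {m n : ℕ} {κ : Type*} (T : κ ↪ Fin n) (B : Matrix (Fin m) κ ℝ) :
    ∃ A : Fin m → Fin n → ℝ, (of A).submatrix id T = B :=
  ⟨fun i => Function.extend T (B i) 0, by ext i k; simp [T.injective.extend_apply]⟩

theorem ae_isGenericMatrix (m n : ℕ) :
    ∀ᵐ A : Fin m → Fin n → ℝ, IsGenericMatrix (of A) := by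
  have h₁ : ∀ S : Fin m ↪ Fin n, ∀ᵐ A : Fin m → Fin n → ℝ,
      ((of A).submatrix id S).det ≠ 0 := fun S => by
    obtain ⟨A, hA⟩ := exists_submatrix_eq S (1 : Matrix (Fin m) (Fin m) ℝ)
    exact ae_det_ne_zero volume (fun i j => analyticOnNhd_entry i (S j)) (a := A) (by simp [hA])
  have h₂ : ∀ (S : Fin m ↪ Fin n) (i j : Fin m), ∀ᵐ A : Fin m → Fin n → ℝ,
      (((of A).submatrix id S).updateCol i (Pi.single j 1)).det ≠ 0 := fun S i j => by
    obtain ⟨A, hA⟩ := exists_submatrix_eq S ((Equiv.swap i j).permMatrix ℝ)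
    refine ae_det_ne_zero volume (fun k l => ?_) (a := A) ?_
    · by_cases hl : l = i
      · subst hl
        simpa using analyticOnNhd_const
      · simpa [updateCol_ne hl] using analyticOnNhd_entry k (S l)
    · have : ((Equiv.swap i j).permMatrix ℝ).updateCol i (Pi.single j 1) =
          (Equiv.swap i j).permMatrix ℝ := by
        ext k l
        by_cases hl : l = i
        · subst hl
          simp [Equiv.Perm.permMatrix, PEquiv.toMatrix_apply, Pi.single_apply,
            Equiv.swap_apply_eq_iff]
        · simp [hl]
      rw [hA, this, det_permutation]
      exact_mod_cast (Equiv.Perm.sign _).ne_zero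
  have h₃ : ∀ (T : Fin m ⊕ Unit ↪ Fin n) (ε : Fin m ⊕ Unit → SignType), (∀ k, ε k ≠ 0) →
      ∀ᵐ A : Fin m → Fin n → ℝ,
        (fromRows ((of A).submatrix id T) (of fun (_ : Unit) k => (ε k : ℝ))).det ≠ 0 := fun T ε hε => by
    obtain ⟨A, hA⟩ := exists_submatrix_eq T (fromCols (1 : Matrix (Fin m) (Fin m) ℝ) 0)
    refine ae_det_ne_zero volume (fun k l => ?_) (a := A) ?_
    · rcases k with k | k
      · exact analyticOnNhd_entry k (T l)
      · exact analyticOnNhd_const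
    · have : fromRows (fromCols (1 : Matrix (Fin m) (Fin m) ℝ) 0)
            (of fun (_ : Unit) k => (ε k : ℝ)) =
          fromBlocks 1 0 (of fun (_ : Unit) k => (ε (.inl k) : ℝ))
            (of fun (_ : Unit) k => (ε (.inr k) : ℝ)) := by
        ext (k | k) (l | l) <;> simp
      rw [hA, this, det_fromBlocks_zero₁₂]
      cases h : ε (.inr ()) <;> simp_all
  filter_upwards [ae_all_iff.2 h₁, ae_all_iff.2 fun S => ae_all_iff.2 fun i => ae_all_iff.2 (h₂ S i),
    ae_all_iff.2 fun T => ae_all_iff.2 fun ε => ae_all_iff.2 (h₃ T ε)] with A h₁ h₂ h₃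
  exact ⟨h₁, h₂, h₃⟩

/-- `x` minimizes the `ℓ¹` norm among the solutions of `A x = b`. -/
def IsL1Min {m n : ℕ} (A : Matrix (Fin m) (Fin n) ℝ) (b : Fin m → ℝ) (x : Fin n → ℝ) : Prop :=
  A *ᵥ x = b ∧ ∀ y, A *ᵥ y = b → ∑ i, |x i| ≤ ∑ i, |y i|

section Minimizers

variable {m n : ℕ} {A : Matrix (Fin m) (Fin n) ℝ} {b : Fin m → ℝ} {x : Fin n → ℝ}

theorem exists_isL1Min (h : ∃ x, A *ᵥ x = b) : ∃ x, IsL1Min A b x := by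
  let s : Set (PiLp 1 fun _ : Fin n => ℝ) := {x | A *ᵥ (x.ofLp) = b}
  have hs : IsClosed s :=
    isClosed_eq (continuous_const.matrix_mulVec (PiLp.continuous_ofLp 1 _)) continuous_const
  obtain ⟨x₀, hx₀⟩ := h
  obtain ⟨x, hx, hmin⟩ := hs.exists_infDist_eq_dist ⟨WithLp.toLp 1 x₀, hx₀⟩ 0
  refine ⟨x.ofLp, hx, fun y hy => ?_⟩
  have := Metric.infDist_le_dist_of_mem (x := 0) (show WithLp.toLp 1 y ∈ s from hy)
  rw [hmin] at this
  simpa [dist_zero_left, PiLp.norm_eq_of_L1] using this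

/-- The first-order optimality condition along feasible directions supported in the support. -/
theorem IsL1Min.sum_sign_mul_eq_zero (hx : IsL1Min A b x) {z : Fin n → ℝ} (hz : A *ᵥ z = 0)
    (hxz : ∀ i, x i = 0 → z i = 0) : ∑ i, (SignType.sign (x i) : ℝ) * z i = 0 := by
  have hderiv : HasDerivAt (fun t : ℝ => ∑ i, |x i + t * z i|)
      (∑ i, (SignType.sign (x i) : ℝ) * z i) 0 := by
    refine HasDerivAt.fun_sum fun i _ => ?_
    by_cases hi : x i = 0
    · simpa [hi, hxz i hi] using hasDerivAt_const (0 : ℝ) (0 : ℝ)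
    · have habs : HasDerivAt (|·|) (SignType.sign (x i) : ℝ) (x i + 0 * z i) := by
        simpa using hasDerivAt_abs hi
      have hlin : HasDerivAt (fun t : ℝ => x i + t * z i) (z i) 0 := by
        simpa using ((hasDerivAt_id (0 : ℝ)).mul_const (z i)).const_add (x i)
      exact habs.comp (0 : ℝ) hlin
  refine IsLocalMin.hasDerivAt_eq_zero (Eventually.of_forall fun t => ?_) hderiv
  simpa using hx.2 (x + t • z) (by rw [mulVec_add, mulVec_smul, hx.1, hz]; simp)

theorem submatrix_mulVec_comp {κ : Type*} [Fintype κ] (S : κ ↪ Fin n)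
    (hS : ∀ i, x i ≠ 0 → i ∈ range S) : A.submatrix id S *ᵥ (x ∘ S) = A *ᵥ x := by
  ext k
  refine Fintype.sum_of_injective S S.injective _ _ (fun i hi => ?_) fun i => rfl
  rw [not_imp_comm.1 (hS i) hi, mul_zero]

theorem exists_embedding_range_superset {s : Finset (Fin n)} (hs : s.card ≤ m) (hmn : m ≤ n) :
    ∃ S : Fin m ↪ Fin n, (s : Set (Fin n)) ⊆ range S := by
  obtain ⟨t, hst, ht⟩ := Finset.exists_superset_card_eq hs (by simpa using hmn)
  exact ⟨(t.orderEmbOfFin ht).toEmbedding, by simpa using hst⟩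

theorem IsGenericMatrix.card_support_le (hA : IsGenericMatrix A) (hx : IsL1Min A b x) :
    (Finset.univ.filter fun i => x i ≠ 0).card ≤ m := by
  by_contra! hcard
  obtain ⟨t, ht, htcard⟩ := Finset.exists_subset_card_eq (Nat.succ_le_of_lt hcard)
  let T : Fin m ⊕ Unit ↪ Fin n :=
    (Fintype.equivFinOfCardEq (α := Fin m ⊕ Unit) (n := m + 1) (by simp)).toEmbedding.trans
      (t.orderEmbOfFin htcard).toEmbedding
  have hT (k) : x (T k) ≠ 0 :=
    (Finset.mem_filter.1 (ht (t.orderEmbOfFin_mem htcard _))).2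
  let M := fromRows (A.submatrix id T)
    (of fun (_ : Unit) k => (SignType.sign (x (T k)) : ℝ))
  have hM : IsUnit M.det := (hA.det_fromRows_ne_zero T (fun k => SignType.sign (x (T k)))
    fun k => by simpa using hT k).isUnit
  let c : Fin m ⊕ Unit → ℝ := Sum.elim 0 1
  let w := M⁻¹ *ᵥ c
  have hMw : M *ᵥ w = c := by
    rw [mulVec_mulVec, mul_nonsing_inv _ hM, one_mulVec]
  rw [fromRows_mulVec] at hMw
  let z := Function.extend T w 0
  have hzT : z ∘ T = w := Function.extend_comp T.injective w 0
  have hz : ∀ i, z i ≠ 0 → i ∈ range T := fun i hi => by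
    contrapose! hi
    exact Function.extend_apply' _ _ _ hi
  have hker : A *ᵥ z = 0 := by
    rw [← submatrix_mulVec_comp T hz, hzT]
    exact funext fun k => congrFun hMw (.inl k)
  have hsum : ∑ i, (SignType.sign (x i) : ℝ) * z i = 1 := by
    refine Eq.trans ?_ (congrFun hMw (.inr ()))
    refine (Fintype.sum_of_injective T T.injective _ _ (fun i hi => ?_) fun k => ?_).symm
    · rw [not_imp_comm.1 (hz i) hi, mul_zero]
    · simp [← hzT]
  refine one_ne_zero (hsum.symm.trans (hx.sum_sign_mul_eq_zero hker fun i hi => ?_))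
  by_contra hzi
  obtain ⟨k, rfl⟩ := hz i hzi
  exact hT k hi

/-- A solution of `A x = eⱼ` supported on `m` columns has full support there. -/
theorem IsGenericMatrix.apply_ne_zero (hA : IsGenericMatrix A) {j : Fin m}
    (hx : A *ᵥ x = Pi.single j 1) (S : Fin m ↪ Fin n) (hS : ∀ i, x i ≠ 0 → i ∈ range S)
    (k : Fin m) : x (S k) ≠ 0 := by
  have hcramer := hA.det_updateCol_ne_zero S k j
  rw [← cramer_apply, ← hx, ← submatrix_mulVec_comp S hS, cramer_eq_adjugate_mulVec,
    mulVec_mulVec, adjugate_mul, smul_mulVec, one_mulVec] at hcramer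
  exact right_ne_zero_of_mul hcramer

theorem IsGenericMatrix.exists_support_eq_range (hA : IsGenericMatrix A) (hmn : m ≤ n)
    {j : Fin m} (hx : IsL1Min A (Pi.single j 1) x) :
    ∃ S : Fin m ↪ Fin n, ∀ i, x i ≠ 0 ↔ i ∈ range S := by
  obtain ⟨S, hS⟩ := exists_embedding_range_superset (hA.card_support_le hx) hmn
  have hS' : ∀ i, x i ≠ 0 → i ∈ range S := fun i hi => hS (by simpa using hi)
  refine ⟨S, fun i => ⟨hS' i, ?_⟩⟩
  rintro ⟨k, rfl⟩
  exact hA.apply_ne_zero hx.1 S hS' k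

theorem IsGenericMatrix.card_support_eq (hA : IsGenericMatrix A) (hmn : m ≤ n)
    {j : Fin m} (hx : IsL1Min A (Pi.single j 1) x) :
    (Finset.univ.filter fun i => x i ≠ 0).card = m := by
  obtain ⟨S, hS⟩ := hA.exists_support_eq_range hmn hx
  have : (Finset.univ.filter fun i => x i ≠ 0) = Finset.univ.map S := by
    ext i
    simp [hS]
  simp [this]

theorem IsL1Min.midpoint {y : Fin n → ℝ} (hx : IsL1Min A b x) (hy : IsL1Min A b y) :
    IsL1Min A b ((2⁻¹ : ℝ) • (x + y)) ∧
      ∀ i, ((2⁻¹ : ℝ) • (x + y)) i = 0 → x i = 0 ∧ y i = 0 := by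
  have hfeas : A *ᵥ ((2⁻¹ : ℝ) • (x + y)) = b := by
    rw [mulVec_smul, mulVec_add, hx.1, hy.1, ← two_smul ℝ b, smul_smul]
    norm_num
  have hle (i) : |((2⁻¹ : ℝ) • (x + y)) i| ≤ 2⁻¹ * (|x i| + |y i|) := by
    simp only [Pi.smul_apply, Pi.add_apply, smul_eq_mul, abs_mul]
    rw [abs_of_pos (by norm_num : (0 : ℝ) < 2⁻¹)]
    gcongr
    exact abs_add_le _ _
  have hxy : ∑ i, |x i| = ∑ i, |y i| := le_antisymm (hx.2 y hy.1) (hy.2 x hx.1)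
  have hsum : ∑ i, 2⁻¹ * (|x i| + |y i|) = ∑ i, |x i| := by
    rw [← Finset.mul_sum, Finset.sum_add_distrib, ← hxy]
    ring
  have hmid : ∑ i, |((2⁻¹ : ℝ) • (x + y)) i| ≤ ∑ i, |x i| :=
    (Finset.sum_le_sum fun i _ => hle i).trans_eq hsum
  refine ⟨⟨hfeas, fun z hz => hmid.trans (hx.2 z hz)⟩, fun i hi => ?_⟩
  have heq := (Finset.sum_eq_sum_iff_of_le fun i _ => hle i).1
    (le_antisymm (Finset.sum_le_sum fun i _ => hle i) (hsum.trans_le (hx.2 _ hfeas))) i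
    (Finset.mem_univ i)
  rw [hi, abs_zero] at heq
  have hx0 := abs_nonneg (x i)
  have hy0 := abs_nonneg (y i)
  constructor <;> refine abs_eq_zero.1 ?_ <;> linarith

theorem IsGenericMatrix.isL1Min_unique (hA : IsGenericMatrix A) (hmn : m ≤ n) {y : Fin n → ℝ}
    (hx : IsL1Min A b x) (hy : IsL1Min A b y) : x = y := by
  obtain ⟨hmin, hzero⟩ := hx.midpoint hy
  obtain ⟨S, hS⟩ := exists_embedding_range_superset (hA.card_support_le hmin) hmn
  have hsupp (i) (hi : i ∉ range S) : x i = 0 ∧ y i = 0 := hzero i <| by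
    contrapose! hi
    exact hS (by simpa using hi)
  have hcomp : x ∘ S = y ∘ S := by
    refine mulVec_injective_of_isUnit
      ((isUnit_iff_isUnit_det _).2 (hA.det_submatrix_ne_zero S).isUnit) ?_
    rw [submatrix_mulVec_comp S fun i => not_imp_comm.1 fun hi => (hsupp i hi).1,
      submatrix_mulVec_comp S fun i => not_imp_comm.1 fun hi => (hsupp i hi).2, hx.1, hy.1]
  ext i
  by_cases hi : i ∈ range S
  · obtain ⟨k, rfl⟩ := hi
    exact congrFun hcomp k
  · rw [(hsupp i hi).1, (hsupp i hi).2]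

theorem IsGenericMatrix.exists_mulVec_eq (hA : IsGenericMatrix A) (hmn : m ≤ n) (b : Fin m → ℝ) :
    ∃ x, A *ᵥ x = b := by
  let S : Fin m ↪ Fin n := Fin.castLEEmb hmn
  let w := (A.submatrix id S)⁻¹ *ᵥ b
  refine ⟨Function.extend S w 0, ?_⟩
  rw [← submatrix_mulVec_comp S fun i hi => ?_, Function.extend_comp S.injective, mulVec_mulVec,
    mul_nonsing_inv _ (hA.det_submatrix_ne_zero S).isUnit, one_mulVec]
  contrapose! hi
  exact Function.extend_apply' _ _ _ hi

theorem mul_eq_one_iff_col {X : Matrix (Fin n) (Fin m) ℝ} :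
    A * X = 1 ↔ ∀ j, A *ᵥ (fun i => X i j) = Pi.single j 1 := by
  rw [← Matrix.ext_iff, forall_comm]
  refine forall_congr' fun j => ?_
  rw [funext_iff]
  refine forall_congr' fun i => ?_
  rw [one_apply, Pi.single_apply]
  rfl

theorem IsGenericMatrix.isGenInverse_iff (hA : IsGenericMatrix A) (hmn : m ≤ n)
    {X : Matrix (Fin n) (Fin m) ℝ} :
    IsGenInverse A X ↔ ∀ j, A *ᵥ (fun i => X i j) = Pi.single j 1 := by
  rw [← mul_eq_one_iff_col]
  refine ⟨fun h => ?_, fun h => by rw [IsGenInverse, h, Matrix.one_mul]⟩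
  choose r hr using fun j => hA.exists_mulVec_eq hmn (Pi.single j 1)
  have hR : A * (of r)ᵀ = 1 := mul_eq_one_iff_col.2 hr
  calc A * X = A * X * A * (of r)ᵀ := by rw [Matrix.mul_assoc _ A, hR, Matrix.mul_one]
    _ = 1 := by rw [show A * X * A = A from h, hR]

theorem IsGenericMatrix.memGinv1_iff (hA : IsGenericMatrix A) (hmn : m ≤ n)
    {X : Matrix (Fin n) (Fin m) ℝ} :
    MemGinv1 A X ↔ ∀ j, IsL1Min A (Pi.single j 1) fun i => X i j := by
  constructor
  · rintro ⟨hX, hmin⟩ j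
    rw [hA.isGenInverse_iff hmn] at hX
    refine ⟨hX j, fun y hy => ?_⟩
    have h := hmin (X.updateCol j y) <| (hA.isGenInverse_iff hmn).2 fun k => by
      by_cases hk : k = j
      · subst hk
        simpa using hy
      · simpa [hk] using hX k
    have hrest : ∑ k ∈ Finset.univ.erase j, ∑ i, |X.updateCol j y i k| =
        ∑ k ∈ Finset.univ.erase j, ∑ i, |X i k| :=
      Finset.sum_congr rfl fun k hk => by simp only [updateCol_ne (Finset.ne_of_mem_erase hk)]
    rw [Finset.sum_comm, Finset.sum_comm (f := fun i k => |X.updateCol j y i k|),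
      ← Finset.add_sum_erase _ (fun k => ∑ i, |X i k|) (Finset.mem_univ j),
      ← Finset.add_sum_erase _ (fun k => ∑ i, |X.updateCol j y i k|) (Finset.mem_univ j),
      hrest] at h
    simpa only [updateCol_self] using le_of_add_le_add_right h
  · refine fun h => ⟨(hA.isGenInverse_iff hmn).2 fun j => (h j).1, fun Y hY => ?_⟩
    rw [Finset.sum_comm, Finset.sum_comm (f := fun i k => |Y i k|)]
    exact Finset.sum_le_sum fun j _ => (h j).2 _ ((hA.isGenInverse_iff hmn).1 hY j)

end Minimizers

/-- Except for a set of matrices `A ∈ ℝ^{m×n}` (`m < n`) of Lebesgue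
measure zero (under the identification of `ℝ^{m×n}` with `ℝ^{mn}`), the set of
`ℓ^1`-norm-minimizing generalized inverses of `A` contains exactly one matrix, and every
column of this matrix has exactly `m` non-zero entries. -/
theorem spinv_generically_unique_and_m_sparse {m n : ℕ} (hmn : m < n) :
    MeasureTheory.volume
      {A : Fin m → Fin n → ℝ |
        ¬∃ X : Matrix (Fin n) (Fin m) ℝ,
            MemGinv1 (Matrix.of A) X ∧
            (∀ Y : Matrix (Fin n) (Fin m) ℝ, MemGinv1 (Matrix.of A) Y → Y = X) ∧
            ∀ j : Fin m, (Finset.univ.filter fun i => X i j ≠ 0).card = m} = 0 := by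
  rw [← ae_iff]
  filter_upwards [ae_isGenericMatrix m n] with A hA
  choose x hx using fun j => exists_isL1Min (hA.exists_mulVec_eq hmn.le (Pi.single j 1))
  refine ⟨(of x)ᵀ, (hA.memGinv1_iff hmn.le).2 hx, fun Y hY => ?_,
    fun j => hA.card_support_eq hmn.le (hx j)⟩
  ext i j
  exact congrFun (hA.isL1Min_unique hmn.le ((hA.memGinv1_iff hmn.le).1 hY j) (hx j)) i
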